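/- arXiv:1309.0195 — 4 statements merged into one kernel-verified Lean document; each statement's English description precedes it below -/
import Mathlib

section
/- (Nested satisfied paths force regenerators everywhere; core of the infeasible-instance lower bound.) Let P = P(s,t) and Q = P(s',t') be distinct interval paths with s ≤ s', t' ≤ t, and t' − s' ≥ 3 (so Q has at least two internal nodes and every internal node of Q is an internal node of P). If a regenerator assignment reg with at most 1 regenerator per node 2-satisfies both P and Q, then every internal node v of Q carries a regenerator, i.e., there exists a lightpath X with reg(v,X) = 1. -/
/-- `v` is an internal node of the interval path `P(s,t)`, where a path is
represented as the pair of its endpoints. -/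
def IsInternal (P : ℤ × ℤ) (v : ℤ) : Prop := P.1 < v ∧ v < P.2

/-- `reg` is a regenerator assignment with at most 1 regenerator per node:
for every node at most one lightpath has a regenerator there, and a
regenerator is placed only at internal nodes. -/
def RegValid (reg : ℤ → ℤ × ℤ → Prop) : Prop :=
  (∀ v : ℤ, ∀ P Q : ℤ × ℤ, reg v P → reg v Q → P = Q) ∧
  (∀ v : ℤ, ∀ P : ℤ × ℤ, reg v P → IsInternal P v)

/-- The lightpath `P` is 2-satisfied by `reg`: for every two consecutive
internal nodes `u`, `u+1` of `P`, a regenerator for `P` is at `u` or `u+1`. -/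
def TwoSat (reg : ℤ → ℤ × ℤ → Prop) (P : ℤ × ℤ) : Prop :=
  ∀ u : ℤ, P.1 < u → u + 1 < P.2 → reg u P ∨ reg (u + 1) P

/-- Nested satisfied paths force regenerators everywhere: if `Q = P(s',t')` is
nested in `P = P(s,t)`, `Q ≠ P`, `Q` has at least two internal nodes, and `reg`
2-satisfies both, then every internal node of `Q` carries a regenerator. -/
theorem stmt10 (s t s' t' : ℤ) (hne : (s, t) ≠ (s', t'))
    (hs : s ≤ s') (ht : t' ≤ t) (hlen : 3 ≤ t' - s')
    (reg : ℤ → ℤ × ℤ → Prop) (hreg : RegValid reg)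
    (hP : TwoSat reg (s, t)) (hQ : TwoSat reg (s', t')) :
    ∀ v : ℤ, IsInternal (s', t') v → ∃ X : ℤ × ℤ, reg v X := by
  rintro v ⟨hsv : s' < v, hvt : v < t'⟩
  by_contra! hv
  by_cases h : v + 1 < t'
  · have hPv := (hP v (show s < v by lia) (show v + 1 < t by lia)).resolve_left (hv _)
    have hQv := (hQ v hsv h).resolve_left (hv _)
    exact hne (hreg.1 _ _ _ hPv hQv)
  · have hPv := hP (v - 1) (show s < v - 1 by lia) (show v - 1 + 1 < t by lia)
    have hQv := hQ (v - 1) (show s' < v - 1 by lia) (show v - 1 + 1 < t' by lia)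
    rw [sub_add_cancel] at hPv hQv
    exact hne (hreg.1 _ _ _ (hPv.resolve_right (hv _)) (hQv.resolve_right (hv _)))
end

section
/- (Infeasibility of a long path, a nested path, and a short path inside it; core of the √l/2 lower bound for infeasible instances.) Let P = P(s,t), Q = P(s',t'), and Q' = P(s'',t'') be pairwise distinct interval paths such that s ≤ s', t' ≤ t, t' − s' ≥ 3, and s' ≤ s'', t'' ≤ t' with t'' − s'' = 3 (so Q' has exactly two internal nodes, both of which are internal nodes of Q, and all internal nodes of Q are internal nodes of P). Then there is no regenerator assignment with at most 1 regenerator per node that 2-satisfies all of P, Q, and Q'. -/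
/-- Infeasibility of a long path `P(s,t)`, a nested path `P(s',t')` with at
least two internal nodes, and a short path `P(s'',t'')` with exactly two
internal nodes nested inside it (all pairwise distinct). -/
theorem stmt11 (s t s' t' s'' t'' : ℤ)
    (h1 : (s, t) ≠ (s', t')) (h2 : (s, t) ≠ (s'', t'')) (h3 : (s', t') ≠ (s'', t''))
    (hs : s ≤ s') (ht : t' ≤ t) (hlen : 3 ≤ t' - s')
    (hs' : s' ≤ s'') (ht' : t'' ≤ t') (hlen' : t'' - s'' = 3) :
    ¬ ∃ reg : ℤ → ℤ × ℤ → Prop,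
        RegValid reg ∧ TwoSat reg (s, t) ∧ TwoSat reg (s', t') ∧
          TwoSat reg (s'', t'') := by
  rintro ⟨reg, ⟨huniq, -⟩, hP, hQ, hQ'⟩
  have hp := hP (s'' + 1) (show s < s'' + 1 by omega) (show s'' + 1 + 1 < t by omega)
  have hq := hQ (s'' + 1) (show s' < s'' + 1 by omega) (show s'' + 1 + 1 < t' by omega)
  have hq' := hQ' (s'' + 1) (show s'' < s'' + 1 by omega) (show s'' + 1 + 1 < t'' by omega)
  rcases hp with hp | hp <;> rcases hq with hq | hq <;> rcases hq' with hq' | hq' <;>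
    first
      | exact h1 (huniq _ _ _ hp hq)
      | exact h2 (huniq _ _ _ hp hq')
      | exact h3 (huniq _ _ _ hq hq')
end

section
/- (Case 2 claim in the proof that the greedy algorithm is 3-competitive: at most two further paths can use one of three consecutive internal edges.) Let x ∈ ℤ and let P, A, B, C be pairwise distinct interval paths such that x, x+1, x+2, x+3 are all internal nodes of P; x+1 and x+2 are internal nodes of A; x and x+1 are internal nodes of B; and x+2 and x+3 are internal nodes of C. Then there is no regenerator assignment with at most 1 regenerator per node that 2-satisfies all four paths P, A, B, C. -/
/-- Case 2 claim in the proof of 3-competitiveness: if `x, x+1, x+2, x+3` are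
internal to `P`, `x+1, x+2` internal to `A`, `x, x+1` internal to `B` and
`x+2, x+3` internal to `C` (all four paths pairwise distinct), then no
assignment with at most one regenerator per node 2-satisfies all four. -/
theorem stmt12 (x : ℤ) (P A B C : ℤ × ℤ)
    (hPA : P ≠ A) (hPB : P ≠ B) (hPC : P ≠ C)
    (hAB : A ≠ B) (hAC : A ≠ C) (hBC : B ≠ C)
    (hP : IsInternal P x ∧ IsInternal P (x + 1) ∧ IsInternal P (x + 2) ∧
      IsInternal P (x + 3))
    (hA : IsInternal A (x + 1) ∧ IsInternal A (x + 2))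
    (hB : IsInternal B x ∧ IsInternal B (x + 1))
    (hC : IsInternal C (x + 2) ∧ IsInternal C (x + 3)) :
    ¬ ∃ reg : ℤ → ℤ × ℤ → Prop,
        RegValid reg ∧ TwoSat reg P ∧ TwoSat reg A ∧ TwoSat reg B ∧
          TwoSat reg C := by
  rintro ⟨reg, ⟨huniq, -⟩, sP, sA, sB, sC⟩
  have e₁ : x + 1 + 1 = x + 2 := by ring
  have e₂ : x + 2 + 1 = x + 3 := by ring
  have hP₀ := sP x hP.1.1 hP.2.1.2
  have hP₂ := sP (x + 2) hP.2.2.1.1 (e₂ ▸ hP.2.2.2.2)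
  have hA₁ := sA (x + 1) hA.1.1 (e₁ ▸ hA.2.2)
  have hB₀ := sB x hB.1.1 hB.2.2
  have hC₂ := sC (x + 2) hC.1.1 (e₂ ▸ hC.2.2)
  rw [e₁] at hA₁
  rw [e₂] at hP₂ hC₂
  have excl : ∀ {Q R : ℤ × ℤ} (v : ℤ), Q ≠ R → reg v Q → ¬ reg v R :=
    fun v hne hQ hR => hne (huniq v _ _ hQ hR)
  rcases hA₁ with a | a
  · have hP := hP₀.resolve_right fun p => excl _ hPA p a
    have hB := hB₀.resolve_right (excl _ hAB a)
    exact excl _ hPB hP hB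
  · have hP := hP₂.resolve_left fun p => excl _ hPA p a
    have hC := hC₂.resolve_left (excl _ hAC a)
    exact excl _ hPC hP hC
end

section
/- (Feasibility of the adversary's instance in the lower bound of 3 for feasible instances.) Let m ≥ 2 and let P₀ = P(0, m). Let I be a finite index set and for each i ∈ I let vᵢ ∈ ℤ satisfy 1 ≤ vᵢ and vᵢ + 4 ≤ m − 1 (so vᵢ, vᵢ+1, ..., vᵢ+4 are internal nodes of P₀), and assume that for distinct i, j ∈ I the blocks [vᵢ, vᵢ+4] and [vⱼ, vⱼ+4] are disjoint and separated by at least one node. For each i define Aᵢ = P(vᵢ, vᵢ+4) (internal nodes vᵢ+1, vᵢ+2, vᵢ+3), Bᵢ = P(vᵢ−1, vᵢ+2) (internal nodes vᵢ, vᵢ+1), and Cᵢ = P(vᵢ+2, vᵢ+5) (internal nodes vᵢ+3, vᵢ+4). Then there exists a regenerator assignment with at most 1 regenerator per node that 2-satisfies P₀ and all of the paths Aᵢ, Bᵢ, Cᵢ for i ∈ I. -/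
/-- Feasibility of the adversary's instance in the lower bound of 3 for
feasible instances: the long path `P(0,m)` together with the triples
`Aᵢ = P(vᵢ, vᵢ+4)`, `Bᵢ = P(vᵢ-1, vᵢ+2)`, `Cᵢ = P(vᵢ+2, vᵢ+5)` over pairwise
separated blocks can all be 2-satisfied with at most one regenerator
per node. -/
theorem stmt13 {ι : Type*} (m : ℤ) (hm : 2 ≤ m) (I : Finset ι) (v : ι → ℤ)
    (hv : ∀ i ∈ I, 1 ≤ v i ∧ v i + 4 ≤ m - 1)
    (hsep : ∀ i ∈ I, ∀ j ∈ I, i ≠ j → v i + 6 ≤ v j ∨ v j + 6 ≤ v i) :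
    ∃ reg : ℤ → ℤ × ℤ → Prop, RegValid reg ∧
      TwoSat reg (0, m) ∧
      ∀ i ∈ I, TwoSat reg (v i, v i + 4) ∧ TwoSat reg (v i - 1, v i + 2) ∧
        TwoSat reg (v i + 2, v i + 5) := by
  refine ⟨fun u P => IsInternal P u ∧
    ((P = (0, m) ∧ ∀ i ∈ I, u ≠ v i ∧ u ≠ v i + 2 ∧ u ≠ v i + 4) ∨
      ∃ i ∈ I, (u = v i ∧ P = (v i - 1, v i + 2)) ∨ (u = v i + 2 ∧ P = (v i, v i + 4)) ∨
        (u = v i + 4 ∧ P = (v i + 2, v i + 5))), ⟨?_, fun u P h => h.1⟩, ?_, ?_⟩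
  · rintro u P Q ⟨-, ⟨rfl, hP⟩ | ⟨i, hi, hP⟩⟩ ⟨-, ⟨rfl, hQ⟩ | ⟨j, hj, hQ⟩⟩
    · rfl
    · have := hP j hj
      omega
    · have := hQ i hi
      omega
    · have hij : i = j := by
        by_contra hne
        have := hsep i hi j hj hne
        omega
      subst hij
      rcases hP with ⟨h, rfl⟩ | ⟨h, rfl⟩ | ⟨h, rfl⟩ <;>
        rcases hQ with ⟨h', rfl⟩ | ⟨h', rfl⟩ | ⟨h', rfl⟩ <;> first | rfl | omega
  · intro u h₀ h₁
    dsimp only at h₀ h₁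
    by_cases hu : ∀ i ∈ I, u ≠ v i ∧ u ≠ v i + 2 ∧ u ≠ v i + 4
    · exact Or.inl ⟨⟨h₀, by dsimp only; omega⟩, Or.inl ⟨rfl, hu⟩⟩
    · refine Or.inr ⟨⟨by dsimp only; omega, h₁⟩, Or.inl ⟨rfl, fun j hj => ?_⟩⟩
      push Not at hu
      obtain ⟨i, hi, hu⟩ := hu
      rcases eq_or_ne i j with rfl | hne
      · omega
      · have := hsep i hi j hj hne
        omega
  · intro i hi
    refine ⟨fun u h₀ h₁ => ?_, fun u h₀ h₁ => ?_, fun u h₀ h₁ => ?_⟩ <;> dsimp only at h₀ h₁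
    · obtain h | h : u = v i + 2 ∨ u + 1 = v i + 2 := by omega
      · exact Or.inl ⟨⟨h₀, by dsimp only; omega⟩, Or.inr ⟨i, hi, Or.inr (Or.inl ⟨h, rfl⟩)⟩⟩
      · exact Or.inr ⟨⟨by dsimp only; omega, h₁⟩, Or.inr ⟨i, hi, Or.inr (Or.inl ⟨h, rfl⟩)⟩⟩
    · exact Or.inl ⟨⟨h₀, by dsimp only; omega⟩,
        Or.inr ⟨i, hi, Or.inl ⟨by omega, rfl⟩⟩⟩
    · exact Or.inr ⟨⟨by dsimp only; omega, h₁⟩,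
        Or.inr ⟨i, hi, Or.inr (Or.inr ⟨by omega, rfl⟩)⟩⟩
end
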